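/- arXiv:1105.3968 — 4 statements merged into one kernel-verified Lean document; each statement's English description precedes it below -/
import Mathlib

section
/- The set {f ∈ Λ : g·f = sgn(g)·f for all g ∈ S₃} of sign-equivariant elements equals d·Λ^{S₃} = {d·h : h ∈ Λ^{S₃}}. Moreover multiplication by d is injective on Λ^{S₃}, so this set is a free Λ^{S₃}-module of rank one generated by d. -/
open MvPolynomial

set_option synthInstance.maxHeartbeats 1000000
set_option maxHeartbeats 4000000

noncomputable section

/-- The ring ℤ[1/2], realized as the subring of ℚ generated by 1/2. -/
abbrev R2 : Type := Subring.closure {(2⁻¹ : ℚ)}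

/-- Λ = ℤ[1/2][λ₁, λ₂], with λ₁ = X 0 and λ₂ = X 1. -/
abbrev Lam : Type := MvPolynomial (Fin 2) R2

/-- A chosen 3-cycle σ₀ in S₃ = Perm (Fin 3). -/
def sig0 : Equiv.Perm (Fin 3) := finRotate 3

/-- A chosen transposition τ₀ in S₃ = Perm (Fin 3); note `tau0 * sig0 * tau0 = sig0 ^ 2`. -/
def tau0 : Equiv.Perm (Fin 3) := Equiv.swap 1 2

/-- c₄ = 16(λ₁² − λ₁λ₂ + λ₂²). -/
def cFour : Lam := 16 * (X 0 ^ 2 - X 0 * X 1 + X 1 ^ 2)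

/-- c₆ = 32(λ₁ + λ₂)(2λ₁² − 5λ₁λ₂ + 2λ₂²). -/
def cSix : Lam := 32 * (X 0 + X 1) * (2 * X 0 ^ 2 - 5 * X 0 * X 1 + 2 * X 1 ^ 2)

/-- Δ = 16λ₁²λ₂²(λ₁ − λ₂)². -/
def Del : Lam := 16 * X 0 ^ 2 * X 1 ^ 2 * (X 0 - X 1) ^ 2

/-- d = λ₁λ₂(λ₁ − λ₂). -/
def dE : Lam := X 0 * X 1 * (X 0 - X 1)

/-- The subalgebra Λ^{S₃} of invariants for an action ρ of S₃ on Λ by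
ℤ[1/2]-algebra automorphisms. -/
def invS (ρ : Equiv.Perm (Fin 3) →* (Lam ≃ₐ[R2] Lam)) : Subalgebra R2 Lam where
  carrier := {f | ∀ g, ρ g f = f}
  mul_mem' := fun hf hg g => by rw [map_mul, hf g, hg g]
  add_mem' := fun hf hg g => by rw [map_add, hf g, hg g]
  algebraMap_mem' := fun r g => by rw [AlgEquiv.commutes]

end
/-!
STATEMENT 4: The set {f ∈ Λ : g·f = sgn(g)·f for all g ∈ S₃} equals
d·Λ^{S₃}, and multiplication by d is injective on Λ^{S₃}, so this set is a free
Λ^{S₃}-module of rank one generated by d = λ₁λ₂(λ₁ − λ₂).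
-/

theorem X_sub_X_dvd_sub_aeval (f : Lam) :
    (X 0 - X 1 : Lam) ∣ f - aeval (fun _ : Fin 2 => (X 1 : Lam)) f := by
  induction f using MvPolynomial.induction_on with
  | C a => simp [MvPolynomial.algebraMap_eq]
  | add p q hp hq =>
    rw [map_add, add_sub_add_comm]
    exact dvd_add hp hq
  | mul_X p i hp =>
    rw [map_mul, aeval_X]
    have hi : (X 0 - X 1 : Lam) ∣ X i - X 1 := by fin_cases i <;> simp
    have := dvd_add (hp.mul_right (X 1)) (hi.mul_left p)
    convert this using 1
    ring

/-- A polynomial negated by an automorphism swapping the variables is divisible by `X 0 - X 1`. -/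
theorem X_sub_X_dvd_of_swap_eq_neg (t : Lam ≃ₐ[R2] Lam) (h₀ : t (X 0) = X 1)
    (h₁ : t (X 1) = X 0) {f : Lam} (hf : t f = -f) : (X 0 - X 1 : Lam) ∣ f := by
  have hcomp : (aeval (fun _ : Fin 2 => (X 1 : Lam))).comp (t : Lam →ₐ[R2] Lam) =
      aeval (fun _ : Fin 2 => (X 1 : Lam)) := by
    ext i : 1
    fin_cases i <;> simp [h₀, h₁]
  have h := DFunLike.congr_fun hcomp f
  change aeval (fun _ : Fin 2 => (X 1 : Lam)) (t f) = _ at h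
  rw [hf, map_neg] at h
  simpa only [neg_eq_self.mp h, sub_zero] using X_sub_X_dvd_sub_aeval f

theorem dE_dvd {f : Lam} (h₀ : (X 0 : Lam) ∣ f) (h₁ : (X 1 : Lam) ∣ f)
    (h₂ : (X 0 - X 1 : Lam) ∣ f) : dE ∣ f := by
  have h01 : ¬ (X 0 : Lam) ∣ X 1 := by simp [X_dvd_X]
  have h10 : ¬ (X 1 : Lam) ∣ X 0 := by simp [X_dvd_X]
  have p0 : Prime (X 0 : Lam) := X_prime
  have p1 : Prime (X 1 : Lam) := X_prime
  obtain ⟨g, rfl⟩ := h₂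
  obtain ⟨g, rfl⟩ := (p0.dvd_or_dvd h₀).resolve_left fun h => h01 ((dvd_sub_right dvd_rfl).mp h)
  obtain h | h := p1.dvd_or_dvd h₁
  · exact absurd ((dvd_sub_left dvd_rfl).mp h) h10
  obtain ⟨g, rfl⟩ := (p1.dvd_or_dvd h).resolve_left h10
  exact ⟨g, by rw [dE]; ring⟩

theorem dE_ne_zero : dE ≠ 0 :=
  mul_ne_zero (mul_ne_zero (X_ne_zero 0) (X_ne_zero 1))
    (sub_ne_zero.mpr fun h => by simpa using X_injective h)

theorem perm_fin_three_eq_mul (g : Equiv.Perm (Fin 3)) :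
    ∃ i : Fin 3, ∃ j : Fin 2, g = sig0 ^ (i : ℕ) * tau0 ^ (j : ℕ) := by
  revert g
  unfold sig0 tau0
  decide

theorem sign_sig0 : Equiv.Perm.sign sig0 = 1 := by unfold sig0; decide

theorem sign_tau0 : Equiv.Perm.sign tau0 = -1 := by unfold tau0; decide

theorem map_dE_eq_sign_smul (ρ : Equiv.Perm (Fin 3) →* (Lam ≃ₐ[R2] Lam))
    (hσ : ρ sig0 dE = dE) (hτ : ρ tau0 dE = -dE) (g : Equiv.Perm (Fin 3)) :
    ρ g dE = (Equiv.Perm.sign g : ℤ) • dE := by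
  obtain ⟨i, j, rfl⟩ := perm_fin_three_eq_mul g
  fin_cases i <;> fin_cases j <;> simp [pow_two, hσ, hτ, sign_sig0, sign_tau0]

theorem statement4 (ρ : Equiv.Perm (Fin 3) →* (Lam ≃ₐ[R2] Lam))
    (hσ₁ : ρ sig0 (X 0) = X 1 - X 0) (hσ₂ : ρ sig0 (X 1) = - X 0)
    (hτ₁ : ρ tau0 (X 0) = X 1) (hτ₂ : ρ tau0 (X 1) = X 0) :
    {f : Lam | ∀ g, ρ g f = (Equiv.Perm.sign g : ℤ) • f} =
      {f : Lam | ∃ h ∈ invS ρ, f = dE * h} ∧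
    ∀ h₁ ∈ invS ρ, ∀ h₂ ∈ invS ρ, dE * h₁ = dE * h₂ → h₁ = h₂ := by
  have hσ : ρ sig0 dE = dE := by
    simp only [dE, map_mul, map_sub, hσ₁, hσ₂]
    ring
  have hτ : ρ tau0 dE = -dE := by
    simp only [dE, map_mul, map_sub, hτ₁, hτ₂]
    ring
  have hd := map_dE_eq_sign_smul ρ hσ hτ
  refine ⟨Set.ext fun f => ⟨fun hf => ?_, ?_⟩, fun h₁ _ h₂ _ h => mul_left_cancel₀ dE_ne_zero h⟩
  · have hf_sig : ρ sig0 f = f := by simpa [sign_sig0] using hf sig0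
    have hf_tau : ρ tau0 f = -f := by simpa [sign_tau0] using hf tau0
    have h₂ := X_sub_X_dvd_of_swap_eq_neg (ρ tau0) hτ₁ hτ₂ hf_tau
    have h₁ : (X 1 : Lam) ∣ f := by
      have h := map_dvd (ρ sig0) h₂
      rw [hf_sig, map_sub, hσ₁, hσ₂] at h
      simpa using h
    have h₀ : (X 0 : Lam) ∣ f := by
      have h := map_dvd (ρ sig0) h₁
      rw [hf_sig, hσ₂] at h
      exact (neg_dvd (a := (X 0 : Lam))).mp h
    obtain ⟨h, rfl⟩ := dE_dvd h₀ h₁ h₂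
    refine ⟨h, fun g => mul_left_cancel₀ dE_ne_zero ?_, rfl⟩
    have hg : ρ g (dE * h) = (Equiv.Perm.sign g : ℤ) • (dE * h) := hf g
    rw [map_mul, hd, smul_mul_assoc] at hg
    obtain hs | hs := Int.units_eq_one_or (Equiv.Perm.sign g) <;>
      simpa only [hs, Units.val_one, Units.val_neg, one_smul, neg_smul, neg_inj]
        using hg
  · rintro ⟨h, hh, rfl⟩ g
    rw [map_mul, hd, hh g, smul_mul_assoc]
end

section
/- The subring Λ^{C₃} of elements of Λ fixed by σ is generated as a ℤ[1/2]-algebra by s = λ₁² − λ₁λ₂ + λ₂², e = (λ₁ + λ₂)(2λ₁² − 5λ₁λ₂ + 2λ₂²), and d = λ₁λ₂(λ₁ − λ₂); and the kernel of the ℤ[1/2]-algebra map ℤ[1/2][S,E,D] → Λ^{C₃} sending S ↦ s, E ↦ e, D ↦ d is the principal ideal generated by E² − 4S³ + 27D². -/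
open MvPolynomial

set_option synthInstance.maxHeartbeats 1000000
set_option maxHeartbeats 4000000

/-!
STATEMENT 8: Λ^{C₃} (the subring fixed by σ) is generated as a ℤ[1/2]-algebra by
s = λ₁² − λ₁λ₂ + λ₂², e = (λ₁ + λ₂)(2λ₁² − 5λ₁λ₂ + 2λ₂²), d = λ₁λ₂(λ₁ − λ₂),
and the kernel of ℤ[1/2][S,E,D] → Λ^{C₃}, S ↦ s, E ↦ e, D ↦ d, is the principal
ideal (E² − 4S³ + 27D²).
-/

/-- s = λ₁² − λ₁λ₂ + λ₂². -/
noncomputable def sP : Lam := X 0 ^ 2 - X 0 * X 1 + X 1 ^ 2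
/-- e = (λ₁ + λ₂)(2λ₁² − 5λ₁λ₂ + 2λ₂²). -/
noncomputable def eP : Lam := (X 0 + X 1) * (2 * X 0 ^ 2 - 5 * X 0 * X 1 + 2 * X 1 ^ 2)

/-- The algebra map ℤ[1/2][S, D] → Λ sending S to s and D to d. -/
noncomputable def evalSD : MvPolynomial (Fin 2) R2 →ₐ[R2] Lam := aeval ![sP, dE]

/-- The involution of Λ fixing λ₁ and sending λ₂ to λ₁ − λ₂. -/
noncomputable def reflection : Lam →ₐ[R2] Lam := aeval ![X 0, X 0 - X 1]

lemma evalSD_X_zero : evalSD (X 0) = sP := by simp [evalSD]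

lemma evalSD_X_one : evalSD (X 1) = dE := by simp [evalSD]

lemma reflection_X_zero : reflection (X 0) = X 0 := by simp [reflection]

lemma reflection_X_one : reflection (X 1) = X 0 - X 1 := by simp [reflection]

lemma map_evalSD (g : Lam →ₐ[R2] Lam) (hs : g sP = sP) (hd : g dE = dE)
    (P : MvPolynomial (Fin 2) R2) : g (evalSD P) = evalSD P := by
  have h : g.comp evalSD = evalSD := by
    refine MvPolynomial.algHom_ext fun i => ?_
    fin_cases i
    · simpa [evalSD] using hs
    · simpa [evalSD] using hd
  exact DFunLike.congr_fun h P

lemma reflection_evalSD (P : MvPolynomial (Fin 2) R2) :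
    reflection (evalSD P) = evalSD P := by
  refine map_evalSD _ ?_ ?_ P
  · simp only [sP, map_add, map_sub, map_mul, map_pow, reflection_X_zero, reflection_X_one]
    ring
  · simp only [dE, map_sub, map_mul, reflection_X_zero, reflection_X_one]
    ring

lemma reflection_eP : reflection eP = -eP := by
  simp only [eP, map_add, map_sub, map_mul, map_pow, map_ofNat, reflection_X_zero,
    reflection_X_one]
  ring

lemma X_zero_add_X_one_ne_zero : (X 0 + X 1 : Lam) ≠ 0 := fun h => by
  simpa using congrArg (MvPolynomial.eval ![(1 : R2), 0]) h

lemma two_mul_X_zero_sub_X_one_ne_zero : (2 * X 0 - X 1 : Lam) ≠ 0 := fun h => by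
  simpa using congrArg (MvPolynomial.eval ![(0 : R2), 1]) h

lemma X_zero_sub_two_mul_X_one_ne_zero : (X 0 - 2 * X 1 : Lam) ≠ 0 := fun h => by
  simpa using congrArg (MvPolynomial.eval ![(1 : R2), 0]) h

lemma eP_ne_zero : eP ≠ 0 := by
  have h : eP = (X 0 + X 1) * ((2 * X 0 - X 1) * (X 0 - 2 * X 1)) := by
    rw [eP]; ring
  rw [h]
  exact mul_ne_zero X_zero_add_X_one_ne_zero
    (mul_ne_zero two_mul_X_zero_sub_X_one_ne_zero X_zero_sub_two_mul_X_one_ne_zero)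

/-- Over ℂ, the invariants `s` and `d` take every pair of values. -/
lemma exists_complex_values (S D : ℂ) :
    ∃ a b : ℂ, a ^ 2 - a * b + b ^ 2 = S ∧ a * b * (a - b) = D := by
  obtain ⟨a, ha⟩ : ∃ a : ℂ, a ^ 3 - S * a - D = 0 := by
    obtain ⟨a, ha⟩ := IsAlgClosed.exists_root
      (Polynomial.X ^ 3 - Polynomial.C S * Polynomial.X - Polynomial.C D : Polynomial ℂ) (by
        have : (Polynomial.X ^ 3 - Polynomial.C S * Polynomial.X - Polynomial.C D :
          Polynomial ℂ).degree = 3 := by compute_degree!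
        rw [this]; norm_num)
    exact ⟨a, by simpa [Polynomial.IsRoot] using ha⟩
  obtain ⟨b, hb⟩ : ∃ b : ℂ, b ^ 2 - a * b + (a ^ 2 - S) = 0 := by
    obtain ⟨b, hb⟩ := IsAlgClosed.exists_root
      (Polynomial.X ^ 2 - Polynomial.C a * Polynomial.X + Polynomial.C (a ^ 2 - S) :
        Polynomial ℂ) (by
        have : (Polynomial.X ^ 2 - Polynomial.C a * Polynomial.X + Polynomial.C (a ^ 2 - S) :
          Polynomial ℂ).degree = 2 := by compute_degree!
        rw [this]; norm_num)
    exact ⟨b, by simpa [Polynomial.IsRoot] using hb⟩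
  exact ⟨a, b, by linear_combination hb, by linear_combination ha - a * hb⟩

lemma evalSD_injective : Function.Injective evalSD := by
  rw [injective_iff_map_eq_zero]
  intro P hP
  have hinj : Function.Injective (algebraMap R2 ℂ) := FaithfulSMul.algebraMap_injective _ _
  apply MvPolynomial.map_injective _ hinj
  rw [map_zero]
  refine MvPolynomial.funext fun x => ?_
  obtain ⟨a, b, hs, hd⟩ := exists_complex_values (x 0) (x 1)
  have h : ((aeval ![a, b] : Lam →ₐ[R2] ℂ).comp evalSD) = aeval x := by
    refine MvPolynomial.algHom_ext fun i => ?_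
    fin_cases i
    · simpa [evalSD, sP] using hs
    · simpa [evalSD, dE] using hd
  have h1 := DFunLike.congr_fun h P
  rw [AlgHom.comp_apply, hP, map_zero] at h1
  rw [eval_map, ← aeval_def, ← h1, map_zero]

lemma evalSD_add_mul_eP_eq_zero {P Q : MvPolynomial (Fin 2) R2}
    (h : evalSD P + eP * evalSD Q = 0) : P = 0 ∧ Q = 0 := by
  have h' := congrArg reflection h
  rw [map_add, map_mul, reflection_evalSD, reflection_evalSD, reflection_eP, map_zero] at h'
  have hP : evalSD P = 0 := by
    have : (2 : Lam) * evalSD P = 0 := by linear_combination h + h'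
    exact (mul_eq_zero.mp this).resolve_left two_ne_zero
  have hQ : evalSD Q = 0 := by
    rw [hP, zero_add] at h
    exact (mul_eq_zero.mp h).resolve_left eP_ne_zero
  exact ⟨evalSD_injective (by rw [hP, map_zero]), evalSD_injective (by rw [hQ, map_zero])⟩

/-- Modulo `E² − 4S³ + 27D²`, every polynomial is of degree at most one in `E`. -/
lemma exists_linear_remainder (f : MvPolynomial (Fin 3) R2) :
    ∃ P Q : MvPolynomial (Fin 2) R2,
      f - (aeval ![X 0, X 2] P + X 1 * aeval ![X 0, X 2] Q) ∈
        Ideal.span {(X 1 ^ 2 - 4 * X 0 ^ 3 + 27 * X 2 ^ 2 : MvPolynomial (Fin 3) R2)} := by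
  induction f using MvPolynomial.induction_on with
  | C r => exact ⟨C r, 0, by simp [MvPolynomial.algebraMap_eq]⟩
  | add f g hf hg =>
    obtain ⟨P, Q, h⟩ := hf
    obtain ⟨P', Q', h'⟩ := hg
    refine ⟨P + P', Q + Q', ?_⟩
    convert Ideal.add_mem _ h h' using 1
    simp only [map_add]
    ring
  | mul_X f i hf =>
    obtain ⟨P, Q, h⟩ := hf
    fin_cases i
    · refine ⟨P * X 0, Q * X 0, ?_⟩
      convert Ideal.mul_mem_right (X 0) _ h using 1
      simp
      ring
    · refine ⟨(4 * X 0 ^ 3 - 27 * X 1 ^ 2) * Q, P, ?_⟩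
      convert Ideal.add_mem _ (Ideal.mul_mem_right (X 1) _ h)
        (Ideal.mul_mem_right (aeval ![X 0, X 2] Q) _ (Ideal.mem_span_singleton_self _)) using 1
      simp only [map_sub, map_mul, map_pow, map_ofNat, aeval_X, Matrix.cons_val_zero,
        Matrix.cons_val_one, Fin.mk_one]
      ring
    · refine ⟨P * X 1, Q * X 1, ?_⟩
      convert Ideal.mul_mem_right (X 2) _ h using 1
      simp
      ring

lemma ker_aeval_sP_eP_dE :
    RingHom.ker (MvPolynomial.aeval ![sP, eP, dE] : MvPolynomial (Fin 3) R2 →ₐ[R2] Lam) =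
      Ideal.span {(X 1 ^ 2 - 4 * X 0 ^ 3 + 27 * X 2 ^ 2 : MvPolynomial (Fin 3) R2)} := by
  have hle : Ideal.span {(X 1 ^ 2 - 4 * X 0 ^ 3 + 27 * X 2 ^ 2 : MvPolynomial (Fin 3) R2)} ≤
      RingHom.ker (aeval ![sP, eP, dE] : MvPolynomial (Fin 3) R2 →ₐ[R2] Lam) := by
    rw [Ideal.span_singleton_le_iff_mem, RingHom.mem_ker]
    simp only [map_add, map_sub, map_mul, map_pow, map_ofNat, aeval_X, Matrix.cons_val, sP, eP,
      dE]
    ring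
  refine le_antisymm (fun f hf => ?_) hle
  obtain ⟨P, Q, h⟩ := exists_linear_remainder f
  have h0 := hle h
  rw [RingHom.mem_ker] at hf h0
  have hc : (aeval ![sP, eP, dE] : MvPolynomial (Fin 3) R2 →ₐ[R2] Lam).comp
      (aeval ![X 0, X 2]) = evalSD := by
    refine MvPolynomial.algHom_ext fun i => ?_
    fin_cases i <;> simp [evalSD]
  have hc' : ∀ P, (aeval ![sP, eP, dE] : MvPolynomial (Fin 3) R2 →ₐ[R2] Lam)
      (aeval ![X 0, X 2] P) = evalSD P := fun P => DFunLike.congr_fun hc P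
  have hX : (aeval ![sP, eP, dE] : MvPolynomial (Fin 3) R2 →ₐ[R2] Lam) (X 1) = eP := by simp
  rw [map_sub, hf, map_add, map_mul, hc', hc', hX, zero_sub, neg_eq_zero] at h0
  obtain ⟨rfl, rfl⟩ := evalSD_add_mul_eP_eq_zero h0
  simpa using h

/-- Λ is spanned over ℤ[1/2][s, d] by 1, λ₁, λ₂, λ₁², λ₁λ₂ and λ₁²λ₂. -/
lemma exists_evalSD_coordinates (f : Lam) :
    ∃ u p q r t v : MvPolynomial (Fin 2) R2,
      f = evalSD u + evalSD p * X 0 + evalSD q * X 1 + evalSD r * X 0 ^ 2 +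
        evalSD t * (X 0 * X 1) + evalSD v * (X 0 ^ 2 * X 1) := by
  induction f using MvPolynomial.induction_on with
  | C r => exact ⟨C r, 0, 0, 0, 0, 0, by simp [evalSD, MvPolynomial.algebraMap_eq]⟩
  | add f g hf hg =>
    obtain ⟨u, p, q, r, t, v, h⟩ := hf
    obtain ⟨u', p', q', r', t', v', h'⟩ := hg
    refine ⟨u + u', p + p', q + q', r + r', t + t', v + v', ?_⟩
    rw [h, h']
    simp only [map_add]
    ring
  | mul_X f i hf =>
    obtain ⟨u, p, q, r, t, v, h⟩ := hf
    rw [h]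
    fin_cases i
    · refine ⟨X 1 * r, u + X 0 * r, X 1 * v, p, q + X 0 * v, t, ?_⟩
      simp only [map_add, map_mul, evalSD_X_zero, evalSD_X_one, sP, dE, Fin.zero_eta]
      ring
    · refine ⟨X 0 * q - X 1 * t, -X 1 * v, u + X 1 * v, -q, p + q + X 0 * v, r + t, ?_⟩
      simp only [map_add, map_sub, map_neg, map_mul, evalSD_X_zero, evalSD_X_one, sP, dE,
        Fin.mk_one]
      ring

/-- The elements 1, λ₁, λ₂, λ₁², λ₁λ₂ of Λ are linearly independent over ℤ[1/2][s, d]. -/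
lemma evalSD_coordinates_eq_zero (σ : Lam →ₐ[R2] Lam)
    (hσ₁ : σ (X 0) = X 1 - X 0) (hσ₂ : σ (X 1) = -X 0) (hσ : ∀ P, σ (evalSD P) = evalSD P)
    {u p q r t : MvPolynomial (Fin 2) R2}
    (h : evalSD u + evalSD p * X 0 + evalSD q * X 1 + evalSD r * X 0 ^ 2 +
      evalSD t * (X 0 * X 1) = 0) :
    evalSD p = 0 ∧ evalSD q = 0 ∧ evalSD r = 0 ∧ evalSD t = 0 := by
  have cancel : ∀ {x y : Lam}, x ≠ 0 → x * y = 0 → y = 0 := fun hx hxy =>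
    (mul_eq_zero.mp hxy).resolve_left hx
  have h1 : evalSD q + evalSD t * X 0 = 0 := by
    have h' := congrArg reflection h
    simp only [map_add, map_mul, map_pow, reflection_evalSD, reflection_X_zero,
      reflection_X_one, map_zero] at h'
    exact cancel X_zero_sub_two_mul_X_one_ne_zero (by linear_combination h' - h)
  have ht : evalSD t = 0 := by
    have h' := congrArg σ h1
    simp only [map_add, map_mul, hσ, hσ₁, map_zero] at h'
    exact cancel two_mul_X_zero_sub_X_one_ne_zero (by linear_combination h1 - h')
  have hq : evalSD q = 0 := by simpa [ht] using h1
  have h2 : evalSD p + evalSD r * X 1 = 0 := by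
    have h' := congrArg σ h
    simp only [map_add, map_mul, map_pow, hσ, hσ₁, hσ₂, map_zero, ht, hq] at h h'
    exact cancel two_mul_X_zero_sub_X_one_ne_zero (by linear_combination h - h')
  have hr : evalSD r = 0 := by
    have h' := congrArg σ h2
    simp only [map_add, map_mul, hσ, hσ₂, map_zero] at h'
    exact cancel X_zero_add_X_one_ne_zero (by linear_combination h2 - h')
  exact ⟨by simpa [hr] using h2, hq, hr, ht⟩

lemma X_zero_dvd_of_mul_eq_three_mul {p v : MvPolynomial (Fin 2) R2}
    (h : X 0 * v = 3 * p) : X 0 ∣ p := by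
  have hX : Prime (X 0 : MvPolynomial (Fin 2) R2) := MvPolynomial.X_prime
  refine (hX.dvd_or_dvd (Dvd.intro v h)).resolve_left ?_
  rintro ⟨w, hw⟩
  have h0 := congrArg (MvPolynomial.eval (0 : Fin 2 → R2)) hw
  rw [map_ofNat, map_mul, eval_X, Pi.zero_apply, zero_mul] at h0
  exact OfNat.ofNat_ne_zero 3 h0

lemma exists_two_mul_eq_one : ∃ c : R2, 2 * c = 1 :=
  ⟨⟨2⁻¹, Subring.subset_closure rfl⟩, Subtype.ext (by
    change (2 : ℚ) * 2⁻¹ = 1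
    norm_num)⟩

lemma evalSD_mem_adjoin (P : MvPolynomial (Fin 2) R2) :
    evalSD P ∈ Algebra.adjoin R2 {sP, eP, dE} := by
  induction P using MvPolynomial.induction_on with
  | C r =>
    rw [← MvPolynomial.algebraMap_eq, AlgHom.commutes]
    exact Subalgebra.algebraMap_mem _ r
  | add P Q hP hQ => rw [map_add]; exact add_mem hP hQ
  | mul_X P i hP =>
    rw [map_mul]
    refine mul_mem hP (Algebra.subset_adjoin ?_)
    fin_cases i <;> simp [evalSD]

lemma mem_adjoin_of_fixed (σ : Lam →ₐ[R2] Lam)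
    (hσ₁ : σ (X 0) = X 1 - X 0) (hσ₂ : σ (X 1) = -X 0) (hσ : ∀ P, σ (evalSD P) = evalSD P)
    {f : Lam} (hf : σ f = f) : f ∈ Algebra.adjoin R2 {sP, eP, dE} := by
  obtain ⟨u, p, q, r, t, v, rfl⟩ := exists_evalSD_coordinates f
  obtain ⟨h1, h2, h3, h4⟩ := evalSD_coordinates_eq_zero σ hσ₁ hσ₂ hσ (u := X 0 * r)
    (p := -2 * p - q - X 0 * v) (q := p - q) (r := t - r) (t := -r - 2 * t) (by
      simp only [map_add, map_mul, map_pow, hσ, hσ₁, hσ₂] at hf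
      simp only [map_sub, map_neg, map_mul, map_ofNat, evalSD_X_zero, sP]
      linear_combination hf)
  have hqp : p = q := by
    rw [map_sub, sub_eq_zero] at h2
    exact evalSD_injective h2
  have ht : t = r := by
    rw [map_sub, sub_eq_zero] at h3
    exact evalSD_injective h3
  subst hqp ht
  have ht0 : evalSD t = 0 := by
    have : (3 : Lam) * evalSD t = 0 := by
      simp only [map_sub, map_neg, map_mul, map_ofNat] at h4
      linear_combination -h4
    exact (mul_eq_zero.mp this).resolve_left (OfNat.ofNat_ne_zero 3)
  have hv : X 0 * -v = 3 * p := by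
    have h0 := evalSD_injective (h1.trans (map_zero evalSD).symm)
    linear_combination h0
  obtain ⟨w, rfl⟩ := X_zero_dvd_of_mul_eq_three_mul hv
  obtain rfl : v = -3 * w := by
    refine mul_left_cancel₀ (MvPolynomial.X_ne_zero (0 : Fin 2)) ?_
    linear_combination -hv
  obtain ⟨c, hc⟩ := exists_two_mul_eq_one
  have hc' : (2 : Lam) * C c = 1 := by
    rw [← map_ofNat (C : R2 →+* Lam) 2, ← map_mul, hc, map_one]
  have key : evalSD u + evalSD (X 0 * w) * X 0 + evalSD (X 0 * w) * X 1 + evalSD t * X 0 ^ 2 +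
      evalSD t * (X 0 * X 1) + evalSD (-3 * w) * (X 0 ^ 2 * X 1) =
      evalSD u + algebraMap R2 Lam c * (evalSD w * (eP - 3 * dE)) := by
    simp only [ht0, map_mul, map_neg, map_ofNat, evalSD_X_zero, MvPolynomial.algebraMap_eq]
    have he : eP - 3 * dE = 2 * (sP * (X 0 + X 1) - 3 * (X 0 ^ 2 * X 1)) := by
      simp only [eP, dE, sP]
      ring
    rw [he]
    linear_combination -(evalSD w * (sP * (X 0 + X 1) - 3 * (X 0 ^ 2 * X 1))) * hc'
  rw [key]
  have hE : eP ∈ Algebra.adjoin R2 {sP, eP, dE} := Algebra.subset_adjoin (by simp)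
  have hD : dE ∈ Algebra.adjoin R2 {sP, eP, dE} := Algebra.subset_adjoin (by simp)
  exact add_mem (evalSD_mem_adjoin u) (mul_mem (Subalgebra.algebraMap_mem _ c)
    (mul_mem (evalSD_mem_adjoin w) (sub_mem hE (mul_mem (ofNat_mem _ 3) hD))))

theorem statement8 (ρ : Equiv.Perm (Fin 3) →* (Lam ≃ₐ[R2] Lam))
    (hσ₁ : ρ sig0 (X 0) = X 1 - X 0) (hσ₂ : ρ sig0 (X 1) = - X 0)
    (hτ₁ : ρ tau0 (X 0) = X 1) (hτ₂ : ρ tau0 (X 1) = X 0) :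
    {f : Lam | ρ sig0 f = f} = (Algebra.adjoin R2 {sP, eP, dE} : Subalgebra R2 Lam) ∧
    RingHom.ker (MvPolynomial.aeval ![sP, eP, dE] :
        MvPolynomial (Fin 3) R2 →ₐ[R2] Lam) =
      Ideal.span {(X 1 ^ 2 - 4 * X 0 ^ 3 + 27 * X 2 ^ 2 : MvPolynomial (Fin 3) R2)} := by
  refine ⟨?_, ker_aeval_sP_eP_dE⟩
  have hs : ρ sig0 sP = sP := by
    simp only [sP, map_add, map_sub, map_mul, map_pow, hσ₁, hσ₂]
    ring
  have he : ρ sig0 eP = eP := by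
    simp only [eP, map_add, map_sub, map_mul, map_pow, map_ofNat, hσ₁, hσ₂]
    ring
  have hd : ρ sig0 dE = dE := by
    simp only [dE, map_sub, map_mul, hσ₁, hσ₂]
    ring
  have hfix := map_evalSD (ρ sig0 : Lam →ₐ[R2] Lam) hs hd
  refine Set.Subset.antisymm
    (fun f hf => mem_adjoin_of_fixed (ρ sig0 : Lam →ₐ[R2] Lam) hσ₁ hσ₂ hfix hf) ?_
  have hle : Algebra.adjoin R2 {sP, eP, dE} ≤
      AlgHom.equalizer (ρ sig0 : Lam →ₐ[R2] Lam) (AlgHom.id R2 Lam) := by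
    rw [Algebra.adjoin_le_iff]
    rintro x (rfl | rfl | rfl)
    exacts [hs, he, hd]
  exact fun f hf => hle hf
end

section
/- The image of the twisted norm map Ñ : Λ → Λ, Ñ(f) = Σ_{g ∈ S₃} sgn(g)·(g·f), equals d·I = {d·h : h ∈ I}, where I is the ideal of the ring Λ^{S₃} generated by 3, c₄, and c₆. -/
open MvPolynomial

set_option synthInstance.maxHeartbeats 1000000
set_option maxHeartbeats 4000000

theorem perm_three_univ :
    (Finset.univ : Finset (Equiv.Perm (Fin 3))) =
      {1, sig0, sig0 * sig0, tau0, sig0 * tau0, sig0 * (sig0 * tau0)} := by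
  decide

theorem perm_three_cases (g : Equiv.Perm (Fin 3)) :
    g = 1 ∨ g = sig0 ∨ g = sig0 * sig0 ∨ g = tau0 ∨ g = sig0 * tau0 ∨
      g = sig0 * (sig0 * tau0) := by
  have h := Finset.mem_univ g
  rw [perm_three_univ] at h
  simpa using h

theorem twisted_norm_eq (ρ : Equiv.Perm (Fin 3) →* (Lam ≃ₐ[R2] Lam)) (f : Lam) :
    ∑ g : Equiv.Perm (Fin 3), (Equiv.Perm.sign g : ℤ) • ρ g f =
      f + ρ sig0 f + ρ sig0 (ρ sig0 f)
        - ρ tau0 f - ρ sig0 (ρ tau0 f) - ρ sig0 (ρ sig0 (ρ tau0 f)) := by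
  have hs : Equiv.Perm.sign sig0 = 1 := by decide
  have ht : Equiv.Perm.sign tau0 = -1 := by decide
  rw [perm_three_univ, Finset.sum_insert (by decide), Finset.sum_insert (by decide),
    Finset.sum_insert (by decide), Finset.sum_insert (by decide),
    Finset.sum_insert (by decide), Finset.sum_singleton]
  simp only [map_mul, hs, ht, map_one, AlgEquiv.mul_apply, AlgEquiv.one_apply, mul_one, one_mul,
    Units.val_one, Units.val_neg, one_smul, neg_smul]
  abel

theorem mem_invS_of_generators {ρ : Equiv.Perm (Fin 3) →* (Lam ≃ₐ[R2] Lam)} {f : Lam}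
    (hs : ρ sig0 f = f) (ht : ρ tau0 f = f) : f ∈ invS ρ := by
  intro g
  rcases perm_three_cases g with rfl | rfl | rfl | rfl | rfl | rfl <;>
    simp [hs, ht]

/-- The invariant quadratic form `λ₁² − λ₁λ₂ + λ₂²`. -/
noncomputable def quadForm : Lam := X 0 ^ 2 - X 0 * X 1 + X 1 ^ 2

/-- The elements `x + d * y` with `x` and `y` invariant. -/
def HasParityDecomp (ρ : Equiv.Perm (Fin 3) →* (Lam ≃ₐ[R2] Lam)) (f : Lam) : Prop :=
  ∃ x ∈ invS ρ, ∃ y ∈ invS ρ, f = x + dE * y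

namespace HasParityDecomp

variable {ρ : Equiv.Perm (Fin 3) →* (Lam ≃ₐ[R2] Lam)} {f g : Lam}

theorem of_mem (hf : f ∈ invS ρ) : HasParityDecomp ρ f :=
  ⟨f, hf, 0, zero_mem _, by ring⟩

theorem add (hf : HasParityDecomp ρ f) (hg : HasParityDecomp ρ g) :
    HasParityDecomp ρ (f + g) := by
  obtain ⟨x, hx, y, hy, rfl⟩ := hf
  obtain ⟨z, hz, w, hw, rfl⟩ := hg
  exact ⟨x + z, add_mem hx hz, y + w, add_mem hy hw, by ring⟩

theorem neg (hf : HasParityDecomp ρ f) : HasParityDecomp ρ (-f) := by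
  obtain ⟨x, hx, y, hy, rfl⟩ := hf
  exact ⟨-x, neg_mem hx, -y, neg_mem hy, by ring⟩

theorem mul_left {r : Lam} (hr : r ∈ invS ρ) (hf : HasParityDecomp ρ f) :
    HasParityDecomp ρ (r * f) := by
  obtain ⟨x, hx, y, hy, rfl⟩ := hf
  exact ⟨r * x, mul_mem hr hx, r * y, mul_mem hr hy, by ring⟩

theorem dE_mul (hd : dE ^ 2 ∈ invS ρ) (hf : HasParityDecomp ρ f) :
    HasParityDecomp ρ (dE * f) := by
  obtain ⟨x, hx, y, hy, rfl⟩ := hf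
  exact ⟨dE ^ 2 * y, mul_mem hd hy, x, hx, by ring⟩

end HasParityDecomp

/-- `Λ` is spanned by the monomials `λ₁ⁱλ₂ʲ` with `i ≤ 2` and `j ≤ 1` over the elements
`x + d * y` with `x` and `y` invariant. -/
theorem exists_monomial_decomp {ρ : Equiv.Perm (Fin 3) →* (Lam ≃ₐ[R2] Lam)}
    (hp : quadForm ∈ invS ρ) (hd : dE ^ 2 ∈ invS ρ) (f : Lam) :
    ∃ a b c a' b' c' : Lam, HasParityDecomp ρ a ∧ HasParityDecomp ρ b ∧ HasParityDecomp ρ c ∧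
      HasParityDecomp ρ a' ∧ HasParityDecomp ρ b' ∧ HasParityDecomp ρ c' ∧
      f = a + b * X 0 + c * X 0 ^ 2 + (a' + b' * X 0 + c' * X 0 ^ 2) * X 1 := by
  have h0 : HasParityDecomp ρ 0 := .of_mem (zero_mem _)
  induction f using MvPolynomial.induction_on with
  | C r =>
    exact ⟨C r, 0, 0, 0, 0, 0, .of_mem ((invS ρ).algebraMap_mem r), h0, h0, h0, h0, h0, by ring⟩
  | add f g hf hg =>
    obtain ⟨a, b, c, a', b', c', ha, hb, hc, ha', hb', hc', rfl⟩ := hf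
    obtain ⟨k, l, m, k', l', m', hk, hl, hm, hk', hl', hm', rfl⟩ := hg
    exact ⟨a + k, b + l, c + m, a' + k', b' + l', c' + m', ha.add hk, hb.add hl, hc.add hm,
      ha'.add hk', hb'.add hl', hc'.add hm', by ring⟩
  | mul_X f i hf =>
    obtain ⟨a, b, c, a', b', c', ha, hb, hc, ha', hb', hc', rfl⟩ := hf
    fin_cases i
    · refine ⟨dE * c, a + quadForm * c, b, dE * c', a' + quadForm * c', b', hc.dE_mul hd,
        ha.add (hc.mul_left hp), hb, hc'.dE_mul hd, ha'.add (hc'.mul_left hp), hb', ?_⟩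
      simp only [dE, quadForm, Fin.zero_eta]
      ring
    · refine ⟨quadForm * a' + -(dE * b'), -(dE * c'), -a', a + dE * c', b + a' + quadForm * c',
        c + b', (ha'.mul_left hp).add (hb'.dE_mul hd).neg, (hc'.dE_mul hd).neg, ha'.neg,
        ha.add (hc'.dE_mul hd), (hb.add ha').add (hc'.mul_left hp), hc.add hb', ?_⟩
      simp only [dE, quadForm, Fin.mk_one]
      ring

theorem exists_two_mul_eq_one_s10 (ρ : Equiv.Perm (Fin 3) →* (Lam ≃ₐ[R2] Lam)) :
    ∃ h ∈ invS ρ, 2 * h = 1 := by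
  let r : R2 := ⟨2⁻¹, Subring.subset_closure rfl⟩
  have hr : (2 : R2) * r = 1 := Subtype.ext (mul_inv_cancel₀ (two_ne_zero (α := ℚ)))
  refine ⟨C r, (invS ρ).algebraMap_mem r, ?_⟩
  rw [← map_ofNat (C : R2 →+* Lam) 2, ← map_mul, hr, map_one]

theorem twisted_norm_monomial_decomp {ρ : Equiv.Perm (Fin 3) →* (Lam ≃ₐ[R2] Lam)}
    (hσ₁ : ρ sig0 (X 0) = X 1 - X 0) (hσ₂ : ρ sig0 (X 1) = - X 0)
    (hτ₁ : ρ tau0 (X 0) = X 1) (hτ₂ : ρ tau0 (X 1) = X 0)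
    {a b c a' b' c' k l m k' l' m' : Lam}
    (ha : a ∈ invS ρ) (hb : b ∈ invS ρ) (hc : c ∈ invS ρ)
    (ha' : a' ∈ invS ρ) (hb' : b' ∈ invS ρ) (hc' : c' ∈ invS ρ)
    (hk : k ∈ invS ρ) (hl : l ∈ invS ρ) (hm : m ∈ invS ρ)
    (hk' : k' ∈ invS ρ) (hl' : l' ∈ invS ρ) (hm' : m' ∈ invS ρ) :
    ∑ g : Equiv.Perm (Fin 3), (Equiv.Perm.sign g : ℤ) •
        ρ g ((a + dE * k) + (b + dE * l) * X 0 + (c + dE * m) * X 0 ^ 2 +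
          ((a' + dE * k') + (b' + dE * l') * X 0 + (c' + dE * m') * X 0 ^ 2) * X 1) =
      dE * (3 * (c' + 2 * k) + quadForm * (4 * m + 2 * l') -
        (X 0 + X 1) * (2 * X 0 ^ 2 - 5 * X 0 * X 1 + 2 * X 1 ^ 2) * m') := by
  rw [twisted_norm_eq]
  simp only [dE, quadForm, map_add, map_sub, map_mul, map_pow, map_neg, hσ₁, hσ₂, hτ₁, hτ₂,
    ha _, hb _, hc _, ha' _, hb' _, hc' _, hk _, hl _, hm _, hk' _, hl' _, hm' _]
  ring

/-!
STATEMENT 10: The image of the twisted norm map Ñ : Λ → Λ,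
Ñ(f) = Σ_{g ∈ S₃} sgn(g)·(g·f), equals d·I, where I is the ideal of the ring
Λ^{S₃} generated by 3, c₄ and c₆.
-/

theorem statement10 (ρ : Equiv.Perm (Fin 3) →* (Lam ≃ₐ[R2] Lam))
    (hσ₁ : ρ sig0 (X 0) = X 1 - X 0) (hσ₂ : ρ sig0 (X 1) = - X 0)
    (hτ₁ : ρ tau0 (X 0) = X 1) (hτ₂ : ρ tau0 (X 1) = X 0) :
    Set.range (fun f : Lam =>
        ∑ g : Equiv.Perm (Fin 3), (Equiv.Perm.sign g : ℤ) • ρ g f) =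
      {y : Lam | ∃ u ∈ invS ρ, ∃ v ∈ invS ρ, ∃ w ∈ invS ρ,
        y = dE * (3 * u + cFour * v + cSix * w)} := by
  have hp : quadForm ∈ invS ρ := by
    apply mem_invS_of_generators <;>
      simp only [quadForm, map_add, map_sub, map_mul, map_pow, hσ₁, hσ₂, hτ₁, hτ₂] <;> ring
  have hd : dE ^ 2 ∈ invS ρ := by
    apply mem_invS_of_generators <;>
      simp only [dE, map_sub, map_mul, map_pow, hσ₁, hσ₂, hτ₁, hτ₂] <;> ring
  ext y
  constructor
  · rintro ⟨f, rfl⟩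
    obtain ⟨_, _, _, _, _, _, ⟨a, ha, k, hk, rfl⟩, ⟨b, hb, l, hl, rfl⟩, ⟨c, hc, m, hm, rfl⟩,
      ⟨a', ha', k', hk', rfl⟩, ⟨b', hb', l', hl', rfl⟩, ⟨c', hc', m', hm', rfl⟩, rfl⟩ :=
      exists_monomial_decomp hp hd f
    obtain ⟨h, hh, h2⟩ := exists_two_mul_eq_one_s10 ρ
    have h16 : 16 * h ^ 4 = 1 := by linear_combination (8 * h ^ 3 + 4 * h ^ 2 + 2 * h + 1) * h2
    have h32 : 32 * h ^ 5 = 1 := by linear_combination 2 * h * h16 + h2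
    refine ⟨c' + (k + k), add_mem hc' (add_mem hk hk),
      h ^ 4 * ((m + m) + (m + m) + (l' + l')),
      mul_mem (pow_mem hh 4)
        (add_mem (add_mem (add_mem hm hm) (add_mem hm hm)) (add_mem hl' hl')),
      -(h ^ 5 * m'), neg_mem (mul_mem (pow_mem hh 5) hm'), ?_⟩
    dsimp only
    rw [twisted_norm_monomial_decomp hσ₁ hσ₂ hτ₁ hτ₂ ha hb hc ha' hb' hc' hk hl hm hk' hl' hm']
    simp only [cFour, cSix, quadForm]
    linear_combination
      -(dE * (X 0 ^ 2 - X 0 * X 1 + X 1 ^ 2) * (4 * m + 2 * l')) * h16 +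
        (dE * (X 0 + X 1) * (2 * X 0 ^ 2 - 5 * X 0 * X 1 + 2 * X 1 ^ 2) * m') * h32
  · rintro ⟨u, hu, v, hv, w, hw, rfl⟩
    have h0 : (0 : Lam) ∈ invS ρ := zero_mem _
    have hv8 : (8 : Lam) * v ∈ invS ρ := mul_mem (ofNat_mem _ 8) hv
    have hw32 : -((32 : Lam) * w) ∈ invS ρ := neg_mem (mul_mem (ofNat_mem _ 32) hw)
    refine ⟨_, (twisted_norm_monomial_decomp hσ₁ hσ₂ hτ₁ hτ₂ h0 h0 h0 h0 h0 hu h0 h0 h0 h0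
      hv8 hw32).trans ?_⟩
    simp only [cFour, cSix, quadForm]
    ring
end

section
/- Since c₄ is S₃-invariant, the S₃-action on Λ extends uniquely to the localization Λ[c₄^{-1}]. The group cohomology H^s(S₃, Λ[c₄^{-1}]) vanishes for all s ≥ 1, and H^0(S₃, Λ[c₄^{-1}]) is the localization (Λ^{S₃})[c₄^{-1}] of the invariant subring. -/
open MvPolynomial

set_option synthInstance.maxHeartbeats 1000000
set_option maxHeartbeats 4000000

/-!
STATEMENT 15: Since c₄ is S₃-invariant, the S₃-action on Λ extends uniquely to
Λ[c₄⁻¹].  The group cohomology H^s(S₃, Λ[c₄⁻¹]) vanishes for all s ≥ 1, and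
H^0(S₃, Λ[c₄⁻¹]) (the invariants of Λ[c₄⁻¹]) is the localization
(Λ^{S₃})[c₄⁻¹]: the invariant elements are exactly those of the form f/c₄ⁿ
with f ∈ Λ^{S₃}.
-/

abbrev S3 := Equiv.Perm (Fin 3)

/-- Λ[c₄⁻¹]. -/
abbrev LocC4 : Type := Localization.Away cFour

/-- The representation of S₃ on an R2-algebra underlying an action by algebra
automorphisms. -/
noncomputable def repOfAut {A : Type} [CommRing A] [Algebra R2 A]
    (ρ' : S3 →* (A ≃ₐ[R2] A)) : Representation R2 S3 A where
  toFun g := (ρ' g).toLinearMap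
  map_one' := by ext f; simp
  map_mul' g h := by ext f; simp

open CategoryTheory in
/-- If the identity of `A` is a trace `∑ g, g T g⁻¹`, then `A` is a direct summand of a coinduced
representation, so its higher cohomology vanishes. -/
theorem isZero_groupCohomology_succ_of_trace_eq_id {k G : Type} [CommRing k] [Group G] [Fintype G]
    (A : Rep.{0} k G) (T : A →ₗ[k] A) (hT : ∀ x, ∑ g, A.ρ g⁻¹ (T (A.ρ g x)) = x) (n : ℕ) :
    Limits.IsZero (groupCohomology A (n + 1)) := by
  let S : Subgroup G := ⊥
  let B : Rep.{0} k G := Rep.coind S.subtype (Rep.res S.subtype A)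
  have hB : Limits.IsZero (groupCohomology B (n + 1)) :=
    (isZero_groupCohomology_succ_of_subsingleton (Rep.res S.subtype A) n).of_iso
      (groupCohomology.coindIso (Rep.res S.subtype A) (n + 1))
  let i : A ⟶ B := Rep.ofHom
    { toFun := fun x => ⟨fun h => A.ρ h x, fun g h => by simp⟩
      map_add' := fun x y => by ext; simp
      map_smul' := fun c x => by ext; simp
      isIntertwining' := fun g => by
        ext x h
        exact (A.ρ.map_mul h g ▸ rfl : A.ρ h (A.ρ g x) = A.ρ (h * g) x) }
  let r : B ⟶ A := Rep.ofHom
    { toFun := fun f => ∑ h, A.ρ h⁻¹ (T (f.1 h))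
      map_add' := fun x y => by simp [Finset.sum_add_distrib]
      map_smul' := fun c x => by simp [Finset.smul_sum]
      isIntertwining' := fun g => by
        ext f
        simp only [LinearMap.comp_apply, LinearMap.coe_mk, AddHom.coe_mk, map_sum]
        refine Fintype.sum_equiv (Equiv.mulRight g) _ _ fun h => ?_
        change A.ρ h⁻¹ (T (f.1 (h * g))) = A.ρ g (A.ρ (h * g)⁻¹ (T (f.1 (h * g))))
        rw [← Module.End.mul_apply (A.ρ g), ← map_mul, mul_inv_rev, mul_inv_cancel_left] }
  have hir : i ≫ r = 𝟙 A := by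
    ext x
    exact hT x
  let F := groupCohomology.functor k G (n + 1)
  have hF : F.map i ≫ F.map r = 𝟙 (F.obj A) := by
    rw [← CategoryTheory.Functor.map_comp, hir, CategoryTheory.Functor.map_id]
  refine (Limits.IsZero.iff_id_eq_zero (F.obj A)).2 (hF ▸ ?_)
  rw [Limits.IsZero.eq_zero_of_tgt (Y := F.obj B) hB (F.map i), Limits.zero_comp]

theorem exists_eq_sig0_pow_mul_tau0_pow (g : S3) :
    ∃ (i : Fin 3) (j : Fin 2), g = sig0 ^ (i : ℕ) * tau0 ^ (j : ℕ) := by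
  revert g
  decide

theorem sum_S3 {M : Type*} [AddCommMonoid M] (f : S3 → M) :
    ∑ g, f g = ∑ i : Fin 3, ∑ j : Fin 2, f (sig0 ^ (i : ℕ) * tau0 ^ (j : ℕ)) := by
  rw [← Fintype.sum_prod_type'
    fun (i : Fin 3) (j : Fin 2) => f (sig0 ^ (i : ℕ) * tau0 ^ (j : ℕ))]
  refine (Function.Bijective.sum_comp
    (e := fun p : Fin 3 × Fin 2 => sig0 ^ (p.1 : ℕ) * tau0 ^ (p.2 : ℕ)) ?_ f).symm
  decide

section Action

variable (ρ : S3 →* (Lam ≃ₐ[R2] Lam))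

theorem map_cFour
    (hσ₁ : ρ sig0 (X 0) = X 1 - X 0) (hσ₂ : ρ sig0 (X 1) = - X 0)
    (hτ₁ : ρ tau0 (X 0) = X 1) (hτ₂ : ρ tau0 (X 1) = X 0) (g : S3) :
    ρ g cFour = cFour := by
  have hσ : ρ sig0 cFour = cFour := by
    simp only [cFour, map_mul, map_add, map_sub, map_pow, map_ofNat, hσ₁, hσ₂]
    ring
  have hτ : ρ tau0 cFour = cFour := by
    simp only [cFour, map_mul, map_add, map_sub, map_pow, map_ofNat, hτ₁, hτ₂]
    ring
  obtain ⟨i, j, rfl⟩ := exists_eq_sig0_pow_mul_tau0_pow g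
  fin_cases i <;> fin_cases j <;> simp [pow_succ, hσ, hτ]

theorem sum_map_sq
    (hσ₁ : ρ sig0 (X 0) = X 1 - X 0) (hσ₂ : ρ sig0 (X 1) = - X 0)
    (hτ₁ : ρ tau0 (X 0) = X 1) :
    ∑ g, ρ g (4 * X 0 ^ 2) = cFour := by
  rw [sum_S3]
  simp only [Fin.sum_univ_succ, Fin.sum_univ_zero]
  have h4 (e : Lam ≃ₐ[R2] Lam) : e 4 = 4 := map_ofNat e 4
  simp [pow_succ, hσ₁, hσ₂, hτ₁, cFour, h4]
  ring

theorem cFour_ne_zero : cFour ≠ 0 := by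
  intro h
  have := congrArg (fun p => ((MvPolynomial.eval ![1, 0] p : R2) : ℚ)) h
  simp [cFour] at this

theorem algebraMap_LocC4_injective : Function.Injective (algebraMap Lam LocC4) :=
  IsLocalization.injective LocC4 (powers_le_nonZeroDivisors_of_noZeroDivisors cFour_ne_zero)

theorem algEquiv_LocC4_ext {e e' : LocC4 ≃ₐ[R2] LocC4}
    (h : ∀ f, e (algebraMap Lam LocC4 f) = e' (algebraMap Lam LocC4 f)) : e = e' := by
  have : (e : LocC4 →+* LocC4) = e' :=
    IsLocalization.ringHom_ext (Submonoid.powers cFour) (RingHom.ext h)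
  ext x
  exact congrArg (fun φ : LocC4 →+* LocC4 => φ x) this

/-- The extension to `Λ[c₄⁻¹]` of an automorphism of `Λ` fixing `c₄`. -/
noncomputable def extendAut (e : Lam ≃ₐ[R2] Lam) (he : e cFour = cFour) :
    LocC4 ≃ₐ[R2] LocC4 :=
  IsLocalization.algEquivOfAlgEquiv (M := Submonoid.powers cFour) (T := Submonoid.powers cFour)
    LocC4 LocC4 e (by
      rw [Submonoid.map_powers]
      exact congrArg Submonoid.powers he)

theorem extendAut_algebraMap (e : Lam ≃ₐ[R2] Lam) (he : e cFour = cFour) (f : Lam) :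
    extendAut e he (algebraMap Lam LocC4 f) = algebraMap Lam LocC4 (e f) :=
  IsLocalization.algEquivOfAlgEquiv_eq ..

theorem existsUnique_extension (h : ∀ g, ρ g cFour = cFour) :
    ∃! ρ' : S3 →* (LocC4 ≃ₐ[R2] LocC4), ∀ (g : S3) (f : Lam),
      ρ' g (algebraMap Lam LocC4 f) = algebraMap Lam LocC4 (ρ g f) := by
  refine ⟨{ toFun := fun g => extendAut (ρ g) (h g), map_one' := ?_, map_mul' := ?_ },
    fun g f => extendAut_algebraMap (ρ g) (h g) f, fun ρ₁ h₁ => ?_⟩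
  · exact algEquiv_LocC4_ext fun f => by simp [extendAut_algebraMap]
  · exact fun g g' => algEquiv_LocC4_ext fun f => by simp [extendAut_algebraMap]
  · ext1 g
    exact algEquiv_LocC4_ext fun f => by simp [extendAut_algebraMap, h₁]

theorem isUnit_algebraMap_cFour_pow (n : ℕ) : IsUnit (algebraMap Lam LocC4 (cFour ^ n)) :=
  IsLocalization.map_units LocC4 (⟨cFour ^ n, n, rfl⟩ : Submonoid.powers cFour)

theorem forall_map_eq_iff {ρ : S3 →* (Lam ≃ₐ[R2] Lam)} {ρ' : S3 →* (LocC4 ≃ₐ[R2] LocC4)}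
    (hρ' : ∀ (g : S3) (f : Lam), ρ' g (algebraMap Lam LocC4 f) = algebraMap Lam LocC4 (ρ g f))
    (h : ∀ g, ρ g cFour = cFour) (x : LocC4) :
    (∀ g, ρ' g x = x) ↔ ∃ (f : Lam) (n : ℕ), (∀ g, ρ g f = f) ∧
      x * algebraMap Lam LocC4 (cFour ^ n) = algebraMap Lam LocC4 f := by
  constructor
  · intro hx
    obtain ⟨⟨f, _, n, rfl⟩, hf⟩ := IsLocalization.surj (Submonoid.powers cFour) x
    refine ⟨f, n, fun g => algebraMap_LocC4_injective ?_, hf⟩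
    rw [← hρ', ← hf, map_mul, hx, hρ', map_pow, h]
  · rintro ⟨f, n, hf, hx⟩ g
    refine (isUnit_algebraMap_cFour_pow n).mul_left_injective ?_
    beta_reduce
    have := congrArg (ρ' g) hx
    rwa [map_mul, hρ', hρ', map_pow, h, hf, ← hx] at this

theorem exists_sum_map_eq_one {ρ : S3 →* (Lam ≃ₐ[R2] Lam)} {ρ' : S3 →* (LocC4 ≃ₐ[R2] LocC4)}
    (hρ' : ∀ (g : S3) (f : Lam), ρ' g (algebraMap Lam LocC4 f) = algebraMap Lam LocC4 (ρ g f))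
    (h : ∀ g, ρ g cFour = cFour) {t : Lam}
    (ht : ∑ g, ρ g t = cFour) : ∃ a : LocC4, ∑ g, ρ' g a = 1 := by
  have hc := isUnit_algebraMap_cFour_pow 1
  rw [pow_one] at hc
  obtain ⟨u, hu⟩ := hc.exists_left_inv
  refine ⟨algebraMap Lam LocC4 t * u, hc.mul_left_injective ?_⟩
  have hsum (g : S3) : ρ' g (algebraMap Lam LocC4 t * u) * algebraMap Lam LocC4 cFour =
      algebraMap Lam LocC4 (ρ g t) := by
    have hg := congrArg (ρ' g) hu
    rw [map_mul, hρ', h, map_one] at hg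
    rw [map_mul, hρ', mul_assoc, hg, mul_one]
  simp only [Finset.sum_mul, hsum, one_mul, ← map_sum, ht]

end Action

theorem statement15 (ρ : S3 →* (Lam ≃ₐ[R2] Lam))
    (hσ₁ : ρ sig0 (X 0) = X 1 - X 0) (hσ₂ : ρ sig0 (X 1) = - X 0)
    (hτ₁ : ρ tau0 (X 0) = X 1) (hτ₂ : ρ tau0 (X 1) = X 0) :
    (∃! ρ' : S3 →* (LocC4 ≃ₐ[R2] LocC4),
      ∀ (g : S3) (f : Lam),
        ρ' g (algebraMap Lam LocC4 f) = algebraMap Lam LocC4 (ρ g f)) ∧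
    ∀ ρ' : S3 →* (LocC4 ≃ₐ[R2] LocC4),
      (∀ (g : S3) (f : Lam),
        ρ' g (algebraMap Lam LocC4 f) = algebraMap Lam LocC4 (ρ g f)) →
      (∀ s : ℕ, 1 ≤ s → ∀ x : groupCohomology (Rep.of (repOfAut (A := LocC4) ρ')) s, x = 0) ∧
      (∀ x : LocC4, (∀ g : S3, ρ' g x = x) ↔
        ∃ (f : Lam) (n : ℕ), (∀ g : S3, ρ g f = f) ∧
          x * algebraMap Lam LocC4 (cFour ^ n) = algebraMap Lam LocC4 f) := by
  have hc := map_cFour ρ hσ₁ hσ₂ hτ₁ hτ₂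
  refine ⟨existsUnique_extension ρ hc, fun ρ' hρ' => ⟨?_, forall_map_eq_iff hρ' hc⟩⟩
  obtain ⟨a, ha⟩ := exists_sum_map_eq_one hρ' hc (sum_map_sq ρ hσ₁ hσ₂ hτ₁)
  intro s hs x
  obtain ⟨n, rfl⟩ := Nat.exists_eq_succ_of_ne_zero (Nat.one_le_iff_ne_zero.1 hs)
  have hT (x : LocC4) : ∑ g, ρ' g⁻¹ (a * ρ' g x) = x := by
    have hg (g : S3) : ρ' g⁻¹ (ρ' g x) = x := by
      rw [← AlgEquiv.mul_apply, ← map_mul, inv_mul_cancel, map_one, AlgEquiv.one_apply]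
    simp only [map_mul, hg]
    have hinv : ∑ g, ρ' g⁻¹ a = 1 := (Equiv.sum_comp (Equiv.inv S3) (ρ' · a)).trans ha
    rw [← Finset.sum_mul, hinv, one_mul]
  have hzero := isZero_groupCohomology_succ_of_trace_eq_id (Rep.of (repOfAut ρ'))
    (LinearMap.mulLeft R2 a) hT n
  exact (ModuleCat.isZero_iff_subsingleton.1 hzero).elim x 0
end
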